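/- Let M₁ and M₂ be n×n complex matrices satisfying the completeness relation M₁†M₁ + M₂†M₂ = 𝟙, and suppose the spectrum of the positive semidefinite matrix M₁†M₁ is contained in the two-element set {α², β²} for some real numbers 0 ≤ α, β ≤ 1. Then there exist unitary n×n matrices U₁, U₂ and an orthogonal projection Π (a Hermitian idempotent matrix) such that M₁ = U₁·(α·Π + β·(𝟙 − Π)) and M₂ = U₂·(√(1−α²)·Π + √(1−β²)·(𝟙 − Π)). -/

import Mathlib

open Matrix

/-- Two endomorphisms of a finite-dimensional inner product space with the same pointwise norms
differ by a linear isometry on the left. -/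
theorem LinearMap.exists_linearIsometry_apply_of_norm_eq {𝕜 V : Type*} [RCLike 𝕜]
    [NormedAddCommGroup V] [InnerProductSpace 𝕜 V] [FiniteDimensional 𝕜 V]
    (f g : V →ₗ[𝕜] V) (h : ∀ x, ‖f x‖ = ‖g x‖) :
    ∃ L : V →ₗᵢ[𝕜] V, ∀ x, L (g x) = f x := by
  obtain ⟨s, hs⟩ := g.rangeRestrict.exists_rightInverse_of_surjective g.range_rangeRestrict
  have hgs (y : LinearMap.range g) : g (s y) = y :=
    congrArg Subtype.val (LinearMap.congr_fun hs y)
  let L : LinearMap.range g →ₗᵢ[𝕜] V :=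
    { toLinearMap := f ∘ₗ s
      norm_map' := fun y => by
        rw [LinearMap.comp_apply, h, hgs, Submodule.coe_norm] }
  refine ⟨L.extend, fun x => ?_⟩
  have hL := L.extend_apply ⟨g x, LinearMap.mem_range_self g x⟩
  refine hL.trans (sub_eq_zero.mp (norm_eq_zero.mp ?_))
  change ‖f (s ⟨g x, _⟩) - f x‖ = 0
  rw [← map_sub, h, map_sub, hgs, sub_self, norm_zero]

namespace Matrix

variable {𝕜 ι : Type*} [RCLike 𝕜] [Fintype ι] [DecidableEq ι]

/-- Square matrices with the same Gram matrix differ by a unitary factor on the left. -/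
theorem exists_unitary_mul_of_conjTranspose_mul_self_eq (A B : Matrix ι ι 𝕜)
    (h : Aᴴ * A = Bᴴ * B) : ∃ U ∈ unitaryGroup ι 𝕜, A = U * B := by
  have key (C : Matrix ι ι 𝕜) (x : EuclideanSpace 𝕜 ι) :
      inner 𝕜 (toEuclideanLin C x) (toEuclideanLin C x) =
        inner 𝕜 (toEuclideanLin (Cᴴ * C) x) x := by
    rw [toLpLin_mul_same, LinearMap.comp_apply, toEuclideanLin_conjTranspose_eq_adjoint,
      LinearMap.adjoint_inner_left]
  have hnorm (x : EuclideanSpace 𝕜 ι) : ‖toEuclideanLin A x‖ = ‖toEuclideanLin B x‖ := by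
    rw [@norm_eq_sqrt_re_inner 𝕜, @norm_eq_sqrt_re_inner 𝕜, key, key, h]
  obtain ⟨L, hL⟩ := LinearMap.exists_linearIsometry_apply_of_norm_eq _ _ hnorm
  have hU : toEuclideanLin (toEuclideanLin.symm L.toLinearMap) = L.toLinearMap :=
    LinearEquiv.apply_symm_apply _ _
  refine ⟨toEuclideanLin.symm L.toLinearMap, ?_, ?_⟩
  · rw [mem_unitaryGroup_iff', star_eq_conjTranspose]
    apply toEuclideanLin.injective
    rw [toLpLin_mul_same, toEuclideanLin_conjTranspose_eq_adjoint, hU, toLpLin_one]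
    ext1 x
    refine ext_inner_right 𝕜 fun y => ?_
    rw [LinearMap.comp_apply, LinearMap.adjoint_inner_left]
    exact L.inner_map_map x y
  · apply toEuclideanLin.injective
    rw [toLpLin_mul_same, hU]
    ext1 x
    exact (hL x).symm

/-- A Hermitian matrix with spectrum in `{a, b}` is `a` times an orthogonal projection plus `b`
times the complementary projection. -/
theorem IsHermitian.exists_projection_of_spectrum_subset_pair {A : Matrix ι ι 𝕜}
    (hA : A.IsHermitian) {a b : 𝕜} (h : spectrum 𝕜 A ⊆ {a, b}) :
    ∃ P : Matrix ι ι 𝕜, Pᴴ = P ∧ P * P = P ∧ A = a • P + b • (1 - P) := by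
  classical
  let φ := Unitary.conjStarAlgAut 𝕜 (Matrix ι ι 𝕜) hA.eigenvectorUnitary
  let D : Matrix ι ι 𝕜 := diagonal fun i => if (hA.eigenvalues i : 𝕜) = a then 1 else 0
  have hD : diagonal (RCLike.ofReal ∘ hA.eigenvalues) = a • D + b • (1 - D) := by
    rw [← diagonal_one, diagonal_sub, ← diagonal_smul, ← diagonal_smul, diagonal_add]
    congr 1
    ext i
    have hi : (hA.eigenvalues i : 𝕜) ∈ ({a, b} : Set 𝕜) :=
      h (hA.spectrum_eq_image_range ▸ ⟨_, ⟨i, rfl⟩, rfl⟩)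
    by_cases ha : (hA.eigenvalues i : 𝕜) = a
    · simp [ha]
    · simpa [ha] using hi
  refine ⟨φ D, ?_, ?_, ?_⟩
  · rw [← star_eq_conjTranspose, ← map_star, star_eq_conjTranspose, diagonal_conjTranspose]
    congr 2
    ext i
    simp [apply_ite]
  · rw [← map_mul, diagonal_mul_diagonal]
    simp [D]
  · conv_lhs => rw [hA.spectral_theorem, hD]
    simp [φ, map_add, map_smul, map_sub]

theorem conjTranspose_mul_self_real_combination_projection {P : Matrix ι ι 𝕜}
    (hP : Pᴴ = P) (hPP : P * P = P) (a b : ℝ) :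
    ((a : 𝕜) • P + (b : 𝕜) • (1 - P))ᴴ * ((a : 𝕜) • P + (b : 𝕜) • (1 - P)) =
      ((a : 𝕜) ^ 2) • P + ((b : 𝕜) ^ 2) • (1 - P) := by
  simp only [conjTranspose_add, conjTranspose_smul, conjTranspose_sub, conjTranspose_one, hP,
    RCLike.star_def, RCLike.conj_ofReal, add_mul, mul_add, smul_mul_smul_comm, mul_sub, sub_mul,
    mul_one, one_mul, hPP, sub_self, smul_zero, add_zero, zero_add, sub_zero, pow_two]

end Matrix

/-- **Structure of two-outcome measurements with two singular values (Theorem 1).**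
If `M₁† M₁ + M₂† M₂ = 1` and the spectrum of `M₁† M₁` is contained in `{α², β²}`
for reals `0 ≤ α, β ≤ 1`, then there are unitaries `U₁, U₂` and an orthogonal
projection `Proj` with `M₁ = U₁ (α Proj + β (1 − Proj))` and
`M₂ = U₂ (√(1−α²) Proj + √(1−β²) (1 − Proj))`. -/
theorem two_outcome_measurement_structure {n : ℕ}
    (M₁ M₂ : Matrix (Fin n) (Fin n) ℂ)
    (hcomp : M₁ᴴ * M₁ + M₂ᴴ * M₂ = 1)
    (α β : ℝ) (hα0 : 0 ≤ α) (hα1 : α ≤ 1) (hβ0 : 0 ≤ β) (hβ1 : β ≤ 1)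
    (hspec : spectrum ℂ (M₁ᴴ * M₁) ⊆ {((α : ℂ) ^ 2), ((β : ℂ) ^ 2)}) :
    ∃ (U₁ U₂ Proj : Matrix (Fin n) (Fin n) ℂ),
      U₁ ∈ Matrix.unitaryGroup (Fin n) ℂ ∧
      U₂ ∈ Matrix.unitaryGroup (Fin n) ℂ ∧
      Projᴴ = Proj ∧ Proj * Proj = Proj ∧
      M₁ = U₁ * ((α : ℂ) • Proj + (β : ℂ) • (1 - Proj)) ∧
      M₂ = U₂ * ((Real.sqrt (1 - α ^ 2) : ℂ) • Proj +
                  (Real.sqrt (1 - β ^ 2) : ℂ) • (1 - Proj)) := by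
  obtain ⟨P, hP, hPP, hM⟩ :=
    (isHermitian_conjTranspose_mul_self M₁).exists_projection_of_spectrum_subset_pair hspec
  have hsq (x : ℝ) (hx0 : 0 ≤ x) (hx1 : x ≤ 1) :
      (Real.sqrt (1 - x ^ 2) : ℂ) ^ 2 = 1 - (x : ℂ) ^ 2 := by
    rw [← Complex.ofReal_pow, Real.sq_sqrt (by nlinarith)]
    push_cast
    rfl
  obtain ⟨U₁, hU₁, h₁⟩ := exists_unitary_mul_of_conjTranspose_mul_self_eq M₁ _
    (hM.trans (conjTranspose_mul_self_real_combination_projection hP hPP α β).symm)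
  have hM₂ : M₂ᴴ * M₂ = ((Real.sqrt (1 - α ^ 2) : ℂ) ^ 2) • P +
      ((Real.sqrt (1 - β ^ 2) : ℂ) ^ 2) • (1 - P) := by
    rw [hsq α hα0 hα1, hsq β hβ0 hβ1, eq_sub_of_add_eq' hcomp, hM]
    module
  obtain ⟨U₂, hU₂, h₂⟩ := exists_unitary_mul_of_conjTranspose_mul_self_eq M₂ _
    (hM₂.trans (conjTranspose_mul_self_real_combination_projection hP hPP _ _).symm)
  exact ⟨U₁, U₂, P, hU₁, hU₂, hP, hPP, h₁, h₂⟩
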